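/- arXiv:2303.06986 — 2 statements merged into one kernel-verified Lean document; each statement's English description precedes it below -/
import Mathlib

section
/- For any finite connected simple graph G, the multiset dimension of G equals the ID-number of G (as values in ℕ∞, where both are ∞ when no multiset resolving set, respectively no ID-coloring, exists). -/
/-- The multiset representation of `u` with respect to `W`: the multiset of distances
from `u` to the elements of `W` (with multiplicity). -/
noncomputable def mrep {V : Type*} (G : SimpleGraph V) (W : Finset V) (u : V) : Multiset ℕ :=
  W.val.map (fun w => G.dist u w)

/-- `W` is a multiset resolving set of `G`: all vertices have pairwise distinct
multiset representations with respect to `W`. -/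
def IsMultisetResolving {V : Type*} (G : SimpleGraph V) (W : Finset V) : Prop :=
  ∀ u v : V, mrep G W u = mrep G W v → u = v

/-- The multiset dimension of `G`: the least cardinality of a multiset resolving set,
`⊤` (i.e. `∞`) if no multiset resolving set exists. -/
noncomputable def multisetDim {V : Type*} (G : SimpleGraph V) : ℕ∞ :=
  ⨅ (W : Finset V) (_ : IsMultisetResolving G W), (W.card : ℕ∞)

/-- `S` is an ID-coloring of a graph of diameter `d`: the codes
`(a_1, …, a_d)`, where `a_i` is the number of vertices of `S` at distance exactly `i`
from the given vertex, are pairwise distinct. -/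
def IsIDColoring {V : Type*} (G : SimpleGraph V) (d : ℕ) (S : Finset V) : Prop :=
  ∀ x y : V,
    (∀ i ∈ Finset.Icc 1 d,
      (S.filter (fun w => G.dist x w = i)).card =
        (S.filter (fun w => G.dist y w = i)).card) →
    x = y

/-- The ID-number of `G`: the least cardinality of an ID-coloring,
`⊤` (i.e. `∞`) if no ID-coloring exists. -/
noncomputable def idNumber {V : Type*} (G : SimpleGraph V) : ℕ∞ :=
  ⨅ (S : Finset V) (_ : IsIDColoring G G.diam S), (S.card : ℕ∞)

theorem mrep_count_aux {V : Type*} (G : SimpleGraph V) (W : Finset V) (u : V) (i : ℕ) :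
    (mrep G W u).count i = (W.filter (fun w => G.dist u w = i)).card := by
  unfold mrep
  rw [Multiset.count_map, Finset.card_def, Finset.filter_val]
  simp only [eq_comm]

theorem code_sum_aux {V : Type*} [Fintype V] (G : SimpleGraph V)
    (hG : G.Connected) (W : Finset V) (u : V) :
    W.card = (W.filter (fun w => G.dist u w = 0)).card +
      ∑ i ∈ Finset.Icc 1 G.diam, (W.filter (fun w => G.dist u w = i)).card := by
  have hd : ∀ w, G.dist u w ≤ G.diam := fun w => by
    haveI := hG.nonempty
    exact SimpleGraph.dist_le_diam (SimpleGraph.connected_iff_ediam_ne_top.mp hG)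
  have h := Finset.card_eq_sum_card_fiberwise (s := W) (t := Finset.range (G.diam + 1))
    (f := fun w => G.dist u w) (fun w _ => by simpa [Nat.lt_succ_iff] using hd w)
  rw [h, Finset.range_eq_Ico, Finset.sum_eq_sum_Ico_succ_bot (Nat.succ_pos _)]
  rfl

theorem resolving_iff_aux {V : Type*} [Fintype V] (G : SimpleGraph V)
    (hG : G.Connected) (W : Finset V) :
    IsMultisetResolving G W ↔ IsIDColoring G G.diam W := by
  haveI := hG.nonempty
  have hd : ∀ u w, G.dist u w ≤ G.diam := fun u w =>
    SimpleGraph.dist_le_diam (SimpleGraph.connected_iff_ediam_ne_top.mp hG)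
  constructor
  · intro h x y hxy
    apply h
    ext i
    rw [mrep_count_aux, mrep_count_aux]
    by_cases hi : i ∈ Finset.Icc 1 G.diam
    · exact hxy i hi
    · rcases Nat.eq_zero_or_pos i with rfl | h0
      · have h1 := code_sum_aux G hG W x
        have h2 := code_sum_aux G hG W y
        rw [Finset.sum_congr rfl hxy] at h1
        omega
      · have hlt : G.diam < i := by
          simp only [Finset.mem_Icc] at hi
          omega
        have hz : ∀ u, W.filter (fun w => G.dist u w = i) = ∅ := fun u =>
          Finset.filter_eq_empty_iff.mpr (fun w _ => by have := hd u w; omega)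
        rw [hz, hz]
  · intro h x y hxy
    apply h
    intro i _
    rw [← mrep_count_aux, ← mrep_count_aux, hxy]

/-- For any finite connected simple graph `G`, the multiset dimension of `G`
equals the ID-number of `G` (as values in `ℕ∞`). -/
theorem multisetDim_eq_idNumber {V : Type*} [Fintype V] (G : SimpleGraph V)
    (hG : G.Connected) :
    multisetDim G = idNumber G := by
  simp only [multisetDim, idNumber, resolving_iff_aux G hG]
end

section
/- Let G be a finite connected simple graph and let u, v be distinct vertices that are twins, i.e., either N(u) = N(v) (equal open neighborhoods) or N[u] = N[v] (equal closed neighborhoods). Then every multiset resolving set of G contains at least one of u and v. -/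
theorem twin_dist_le {V : Type*} (G : SimpleGraph V) (hG : G.Connected) (u v w : V)
    (hvw : v ≠ w) (h : ∀ x, x ≠ u → G.Adj v x → G.Adj u x) : G.dist u w ≤ G.dist v w := by
  obtain ⟨p, hp⟩ := hG.exists_walk_length_eq_dist v w
  rw [← hp]
  cases p with
  | nil => exact absurd rfl hvw
  | @cons _ x _ hx q =>
    by_cases hxu : x = u
    · subst hxu
      have := SimpleGraph.dist_le q
      simp only [SimpleGraph.Walk.length_cons]
      omega
    · have := SimpleGraph.dist_le (SimpleGraph.Walk.cons (h x hxu hx) q)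
      simpa using this

/-- If distinct vertices `u`, `v` of a finite connected simple graph `G`
are twins (equal open neighborhoods or equal closed neighborhoods), then every multiset
resolving set of `G` contains at least one of them. -/
theorem twins_mem_multisetResolving {V : Type*} [Fintype V] (G : SimpleGraph V)
    (hG : G.Connected) (u v : V) (huv : u ≠ v)
    (htwin : G.neighborSet u = G.neighborSet v ∨
      insert u (G.neighborSet u) = insert v (G.neighborSet v))
    (W : Finset V) (hW : IsMultisetResolving G W) :
    u ∈ W ∨ v ∈ W := by
  by_contra hcon
  push Not at hcon
  obtain ⟨hu, hv⟩ := hcon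
  have h1 : ∀ x, x ≠ u → G.Adj v x → G.Adj u x := by
    intro x hx hvx
    rcases htwin with h | h
    · have : x ∈ G.neighborSet v := hvx
      rw [← h] at this
      exact this
    · have : x ∈ insert v (G.neighborSet v) := Or.inr hvx
      rw [← h] at this
      exact this.resolve_left hx
  have h2 : ∀ x, x ≠ v → G.Adj u x → G.Adj v x := by
    intro x hx hux
    rcases htwin with h | h
    · have : x ∈ G.neighborSet u := hux
      rw [h] at this
      exact this
    · have : x ∈ insert u (G.neighborSet u) := Or.inr hux
      rw [h] at this
      exact this.resolve_left hx
  apply huv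
  apply hW
  unfold mrep
  apply Multiset.map_congr rfl
  intro w hw
  have hw' : w ∈ W := hw
  have hwu : u ≠ w := fun e => hu (e ▸ hw')
  have hwv : v ≠ w := fun e => hv (e ▸ hw')
  exact le_antisymm (twin_dist_le G hG u v w hwv h1) (twin_dist_le G hG v u w hwu h2)
end
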